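/- Let (X,f) be a dynamical system and g ∈ D_m(I). Suppose the g-fuzzification f̃_g is sensitively dependent on initial conditions on (F_0(X), d_∞), i.e., there exists δ > 0 such that for every A ∈ F_0(X) and every ε > 0 there exist B ∈ F_0(X) with d_∞(A,B) < ε and n ∈ ℤ⁺ with d_∞((f̃_g)ⁿ(A), (f̃_g)ⁿ(B)) > δ. Then the induced set-valued map f̄ on the hyperspace (K(X), d_H) is sensitively dependent on initial conditions. -/

import Mathlib

noncomputable section

open Set Metric

/-- The unit interval `I = [0,1]` as a subset of `ℝ`. -/
def I01 : Set ℝ := Set.Icc 0 1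

/-- `g ∈ D_m(I)`: `g : I → I` is nondecreasing, right-continuous, `g 0 = 0`, `g 1 = 1`. -/
def Dm (g : ℝ → ℝ) : Prop :=
  MonotoneOn g I01 ∧
  (∀ x ∈ I01, ContinuousWithinAt g (I01 ∩ Set.Ici x) x) ∧
  Set.MapsTo g I01 I01 ∧ g 0 = 0 ∧ g 1 = 1

/-- `ξ_g x = min g⁻¹([x,1])` (the min exists by right-continuity; `sInf` here). -/
def xiG (g : ℝ → ℝ) (x : ℝ) : ℝ := sInf {t | t ∈ I01 ∧ x ≤ g t}

/-- The `α`-cut `[A]_α` of a fuzzy set `A`. -/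
def cut {X : Type*} (A : X → ℝ) (α : ℝ) : Set X := {x | α ≤ A x}

/-- The support of a fuzzy set. -/
def supp {X : Type*} [TopologicalSpace X] (A : X → ℝ) : Set X := closure {x | 0 < A x}

/-- The `g`-cut `[A]_α^g = {x ∈ supp A : g (A x) ≥ α}`. -/
def gcut {X : Type*} [TopologicalSpace X] (g : ℝ → ℝ) (A : X → ℝ) (α : ℝ) : Set X :=
  {x | x ∈ supp A ∧ α ≤ g (A x)}

/-- `A ∈ F(X)`: an upper semicontinuous fuzzy set on `X`. -/
def IsFuzzy {X : Type*} [TopologicalSpace X] (A : X → ℝ) : Prop :=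
  UpperSemicontinuous A ∧ ∀ x, A x ∈ I01

/-- `A ∈ F_0(X)`: a nonempty (not identically 0) upper semicontinuous fuzzy set. -/
def InF0 {X : Type*} [TopologicalSpace X] (A : X → ℝ) : Prop := IsFuzzy A ∧ ∃ x, A x ≠ 0

/-- `A ∈ F^1(X)`: an upper semicontinuous fuzzy set attaining the value 1. -/
def InF1 {X : Type*} [TopologicalSpace X] (A : X → ℝ) : Prop := IsFuzzy A ∧ ∃ x, 1 ≤ A x

/-- The `g`-fuzzification `f̃_g(A)(x) = sup {g (A y) : y ∈ f⁻¹(x)}` (with `sup ∅ = 0`). -/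
def fuzz {X : Type*} (f : X → X) (g : ℝ → ℝ) (A : X → ℝ) : X → ℝ :=
  fun x => sSup ((fun y => g (A y)) '' (f ⁻¹' {x}))

open Classical in
/-- Hausdorff metric, extended by `d_H(∅,∅) = 0` and `d_H(∅,A) = diam X`. -/
def dH {X : Type*} [MetricSpace X] (A B : Set X) : ℝ :=
  if A = ∅ ∧ B = ∅ then 0
  else if A = ∅ ∨ B = ∅ then Metric.diam (Set.univ : Set X)
  else Metric.hausdorffDist A B

/-- The levelwise metric `d_∞(A,B) = sup {d_H([A]_α, [B]_α) : α ∈ (0,1]}`. -/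
def dInfty {X : Type*} [MetricSpace X] (A B : X → ℝ) : ℝ :=
  sSup ((fun α => dH (cut A α) (cut B α)) '' Set.Ioc (0:ℝ) 1)

/-- `K(X)`: the hyperspace of nonempty compact subsets of `X`. -/
def Kc (X : Type*) [MetricSpace X] : Set (Set X) := {A | IsCompact A ∧ A.Nonempty}

section Dyn

variable {Y : Type*}

/-- `U` is a (relatively) open subset of the space `(S, ρ)`. -/
def IsOpenIn (S : Set Y) (ρ : Y → Y → ℝ) (U : Set Y) : Prop :=
  U ⊆ S ∧ ∀ x ∈ U, ∃ ε > 0, ∀ y ∈ S, ρ x y < ε → y ∈ U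

/-- Diameter of a set with respect to the distance function `ρ`. -/
def diamIn (ρ : Y → Y → ℝ) (U : Set Y) : ℝ := sSup (Set.image2 ρ U U)

/-- Sensitive dependence on initial conditions of `T` on the space `(S, ρ)`. -/
def SensitiveOn (S : Set Y) (ρ : Y → Y → ℝ) (T : Y → Y) : Prop :=
  ∃ δ > 0, ∀ x ∈ S, ∀ ε > 0, ∃ y ∈ S, ρ x y < ε ∧ ∃ n : ℕ, δ < ρ (T^[n] x) (T^[n] y)

/-- `𝓕`-sensitivity of `T` on the space `(S, ρ)`. -/
def FSensitiveOn (S : Set Y) (ρ : Y → Y → ℝ) (T : Y → Y) (F : Set (Set ℕ)) : Prop :=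
  ∃ ε > 0, ∀ U : Set Y, IsOpenIn S ρ U → U.Nonempty →
    {n : ℕ | ε < diamIn ρ (T^[n] '' U)} ∈ F

/-- Multi-sensitivity of `T` on the space `(S, ρ)`. -/
def MultiSensitiveOn (S : Set Y) (ρ : Y → Y → ℝ) (T : Y → Y) : Prop :=
  ∃ ε > 0, ∀ (k : ℕ) (U : Fin k → Set Y),
    (∀ i, IsOpenIn S ρ (U i) ∧ (U i).Nonempty) →
    ∃ n : ℕ, ∀ i, ε < diamIn ρ (T^[n] '' U i)

/-- Topological transitivity of `T` on the space `(S, ρ)`. -/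
def TransitiveOn (S : Set Y) (ρ : Y → Y → ℝ) (T : Y → Y) : Prop :=
  ∀ U V : Set Y, IsOpenIn S ρ U → U.Nonempty → IsOpenIn S ρ V → V.Nonempty →
    ∃ n : ℕ, ((T^[n] '' U) ∩ V).Nonempty

/-- Weak mixing: `T × T` is transitive on `(S × S, max-metric)`. -/
def WeaklyMixingOn (S : Set Y) (ρ : Y → Y → ℝ) (T : Y → Y) : Prop :=
  TransitiveOn (S ×ˢ S) (fun p q => max (ρ p.1 q.1) (ρ p.2 q.2)) (Prod.map T T)

end Dyn

/-- A (proper) Furstenberg family on `ℤ⁺ = ℕ`. -/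
def FurstenbergFamily (F : Set (Set ℕ)) : Prop :=
  (∀ F1 F2 : Set ℕ, F1 ∈ F → F1 ⊆ F2 → F2 ∈ F) ∧ Set.univ ∈ F ∧ ∅ ∉ F

lemma Dm.exists_threshold {g : ℝ → ℝ} (hg : Dm g) {α : ℝ} (hα : α ∈ Ioc (0 : ℝ) 1) :
    ∃ β ∈ Ioc (0 : ℝ) 1, ∀ t ∈ I01, α ≤ g t ↔ β ≤ t := by
  obtain ⟨hmono, hcont, -, h0, h1⟩ := hg
  set S : Set ℝ := {t | t ∈ I01 ∧ α ≤ g t}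
  have hone : (1 : ℝ) ∈ S := ⟨right_mem_Icc.2 zero_le_one, hα.2.trans_eq h1.symm⟩
  have hbdd : BddBelow S := ⟨0, fun t ht => ht.1.1⟩
  have hI : sInf S ∈ I01 :=
    ⟨le_csInf ⟨1, hone⟩ fun t ht => ht.1.1, csInf_le hbdd hone⟩
  have hmin : α ≤ g (sInf S) := by
    by_contra! hlt
    have hev := (hcont _ hI).eventually (gt_mem_nhds hlt)
    obtain ⟨ε, hε, hball⟩ := Metric.mem_nhdsWithin_iff.1 hev
    obtain ⟨t, ht, htlt⟩ := exists_lt_of_csInf_lt ⟨1, hone⟩ (lt_add_of_pos_right (sInf S) hε)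
    have hle : sInf S ≤ t := csInf_le hbdd ht
    have hdist : t ∈ ball (sInf S) ε := by
      rw [mem_ball, Real.dist_eq, abs_of_nonneg (sub_nonneg.2 hle)]
      linarith
    exact (hball ⟨hdist, ht.1, hle⟩ : g t < α).not_ge ht.2
  refine ⟨sInf S, ⟨lt_of_le_of_ne hI.1 fun h => ?_, hI.2⟩, fun t ht =>
    ⟨fun h => csInf_le hbdd ⟨ht, h⟩, fun h => hmin.trans (hmono hI ht h)⟩⟩
  rw [← h, h0] at hmin
  exact hmin.not_gt hα.1

lemma IsFuzzy.isCompact_cut {X : Type*} [TopologicalSpace X] [CompactSpace X] {A : X → ℝ}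
    (hA : IsFuzzy A) (α : ℝ) : IsCompact (cut A α) :=
  (upperSemicontinuous_iff_isClosed_preimage.1 hA.1 α).isCompact

lemma exists_cut_fuzz_eq {X : Type*} [TopologicalSpace X] [T1Space X] [CompactSpace X]
    {f : X → X} (hf : Continuous f) {g : ℝ → ℝ} (hg : Dm g) {A : X → ℝ} (hA : IsFuzzy A)
    {α : ℝ} (hα : α ∈ Ioc (0 : ℝ) 1) :
    ∃ β ∈ Ioc (0 : ℝ) 1, cut (fuzz f g A) α = f '' cut A β := by
  obtain ⟨β, hβ, hthr⟩ := hg.exists_threshold hα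
  refine ⟨β, hβ, Subset.antisymm (fun x hx => ?_) ?_⟩
  · have hx : α ≤ sSup ((fun y => g (A y)) '' (f ⁻¹' {x})) := hx
    have hne : (f ⁻¹' {x}).Nonempty := by
      by_contra! hempty
      rw [hempty, image_empty, Real.sSup_empty] at hx
      exact hx.not_gt hα.1
    have hcomp : IsCompact (f ⁻¹' {x}) := (isClosed_singleton.preimage hf).isCompact
    obtain ⟨y, hy, hmax⟩ := UpperSemicontinuousOn.exists_isMaxOn hne hcomp (hA.1.upperSemicontinuousOn _)
    refine ⟨y, (hthr _ (hA.2 y)).1 (hx.trans (csSup_le (hne.image _) ?_)), hy⟩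
    rintro _ ⟨z, hz, rfl⟩
    exact hg.1 (hA.2 z) (hA.2 y) (hmax hz)
  · rintro _ ⟨y, hy, rfl⟩
    have hbdd : BddAbove ((fun z => g (A z)) '' (f ⁻¹' {f y})) := by
      refine ⟨1, ?_⟩
      rintro _ ⟨z, -, rfl⟩
      exact (hg.2.2.1 (hA.2 z)).2
    exact ((hthr _ (hA.2 y)).2 hy).trans (le_csSup hbdd ⟨y, rfl, rfl⟩)

lemma IsFuzzy.fuzz {X : Type*} [TopologicalSpace X] [T2Space X] [CompactSpace X]
    {f : X → X} (hf : Continuous f) {g : ℝ → ℝ} (hg : Dm g) {A : X → ℝ} (hA : IsFuzzy A) :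
    IsFuzzy (fuzz f g A) := by
  have hI : ∀ x, _root_.fuzz f g A x ∈ I01 := fun x => by
    constructor
    · refine Real.sSup_nonneg ?_
      rintro _ ⟨z, -, rfl⟩
      exact (hg.2.2.1 (hA.2 z)).1
    · refine Real.sSup_le ?_ zero_le_one
      rintro _ ⟨z, -, rfl⟩
      exact (hg.2.2.1 (hA.2 z)).2
  refine ⟨upperSemicontinuous_iff_isClosed_preimage.2 fun α => ?_, hI⟩
  change IsClosed (cut (_root_.fuzz f g A) α)
  rcases le_or_gt α 0 with h0 | h0
  · convert isClosed_univ
    exact eq_univ_of_forall fun x => h0.trans (hI x).1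
  rcases le_or_gt α 1 with h1 | h1
  · obtain ⟨β, -, hβ⟩ := exists_cut_fuzz_eq hf hg hA ⟨h0, h1⟩
    rw [hβ]
    exact ((hA.isCompact_cut β).image hf).isClosed
  · convert isClosed_empty
    exact eq_empty_of_forall_notMem fun x hx => (h1.trans_le hx).not_ge (hI x).2

lemma exists_cut_iterate_fuzz_eq {X : Type*} [TopologicalSpace X] [T2Space X] [CompactSpace X]
    {f : X → X} (hf : Continuous f) {g : ℝ → ℝ} (hg : Dm g) (n : ℕ) {A : X → ℝ}
    (hA : IsFuzzy A) {α : ℝ} (hα : α ∈ Ioc (0 : ℝ) 1) :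
    ∃ β ∈ Ioc (0 : ℝ) 1, cut ((fuzz f g)^[n] A) α = (image f)^[n] (cut A β) := by
  induction n generalizing A with
  | zero => exact ⟨α, hα, rfl⟩
  | succ n ih =>
    obtain ⟨β, hβ, h⟩ := ih (hA.fuzz hf hg)
    obtain ⟨γ, hγ, h'⟩ := exists_cut_fuzz_eq hf hg hA hβ
    exact ⟨γ, hγ, by rw [Function.iterate_succ_apply, h, h', Function.iterate_succ_apply]⟩

lemma cut_indicator_one {X : Type*} (K : Set X) {α : ℝ} (hα : α ∈ Ioc (0 : ℝ) 1) :
    cut (K.indicator 1) α = K := by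
  ext x
  by_cases hx : x ∈ K
  · simp [cut, hx, hα.2]
  · simp [cut, hx, hα.1]

lemma inF0_indicator_one {X : Type*} [TopologicalSpace X] {K : Set X} (hK : IsClosed K)
    (hne : K.Nonempty) : InF0 (K.indicator (1 : X → ℝ)) := by
  refine ⟨⟨hK.upperSemicontinuous_indicator zero_le_one, fun x => ?_⟩, ?_⟩
  · by_cases hx : x ∈ K <;> simp [I01, hx]
  · obtain ⟨x, hx⟩ := hne
    exact ⟨x, by simp [hx]⟩

lemma dH_le_diam_univ {X : Type*} [MetricSpace X] [CompactSpace X] (A B : Set X) :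
    dH A B ≤ diam (univ : Set X) := by
  unfold dH
  split_ifs with h h'
  · exact diam_nonneg
  · exact le_rfl
  · push Not at h'
    exact (hausdorffDist_le_diam h'.1 isBounded_of_compactSpace h'.2
      isBounded_of_compactSpace).trans (diam_mono (subset_univ _) isBounded_of_compactSpace)

lemma dH_empty_right {X : Type*} [MetricSpace X] {A : Set X} (hA : A.Nonempty) :
    dH A ∅ = diam (univ : Set X) := by
  simp [dH, hA.ne_empty]

lemma dH_cut_le_dInfty {X : Type*} [MetricSpace X] [CompactSpace X] (A B : X → ℝ) {α : ℝ}
    (hα : α ∈ Ioc (0 : ℝ) 1) : dH (cut A α) (cut B α) ≤ dInfty A B := by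
  refine le_csSup ⟨diam (univ : Set X), ?_⟩ ⟨α, hα, rfl⟩
  rintro _ ⟨β, -, rfl⟩
  exact dH_le_diam_univ _ _

/-- If the `g`-fuzzification `f̃_g` is sensitively dependent on
`(F_0(X), d_∞)`, then `f̄` is sensitively dependent on `(K(X), d_H)`. -/
theorem stmt8 {X : Type*} [MetricSpace X] [CompactSpace X]
    (f : X → X) (hf : Continuous f) (g : ℝ → ℝ) (hg : Dm g)
    (h : SensitiveOn {A : X → ℝ | InF0 A} dInfty (fuzz f g)) :
    SensitiveOn (Kc X) dH (Set.image f) := by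
  obtain ⟨δ, hδ, h⟩ := h
  refine ⟨δ, hδ, fun K ⟨hK, hne⟩ ε hε => ?_⟩
  have hχ := inF0_indicator_one hK.isClosed hne
  obtain ⟨B, hB, hlt, n, hn⟩ := h _ hχ (min ε δ) (lt_min hε hδ)
  obtain ⟨_, ⟨α, hα, rfl⟩, hα'⟩ :=
    exists_lt_of_lt_csSup ((nonempty_Ioc.2 zero_lt_one).image _) hn
  obtain ⟨γ, hγ, hcutK⟩ := exists_cut_iterate_fuzz_eq hf hg n hχ.1 hα
  obtain ⟨β, hβ, hcutB⟩ := exists_cut_iterate_fuzz_eq hf hg n hB.1 hα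
  dsimp only at hα'
  rw [hcutK, hcutB, cut_indicator_one K hγ] at hα'
  have hclose := (dH_cut_le_dInfty (K.indicator 1) B hβ).trans_lt hlt
  rw [cut_indicator_one K hβ] at hclose
  refine ⟨cut B β, ⟨hB.1.isCompact_cut β, ?_⟩, hclose.trans_le (min_le_left _ _), n, hα'⟩
  by_contra! hempty
  rw [hempty, dH_empty_right hne] at hclose
  exact (hα'.trans_le (dH_le_diam_univ _ _)).not_gt (hclose.trans_le (min_le_right _ _))
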